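/- arXiv:2005.08593 — 5 statements merged into one kernel-verified Lean document; each statement's English description precedes it below -/
import Mathlib

section
/- For every fixed secret x ∈ F^r and every subset J ⊆ {0,…,n−1} of exactly k−1 indices, the map sending the randomness tuple (r^{(1)},…,r^{(k−1)}) ∈ (F^r)^{k−1} to the tuple of shares (s^{(h)}(x, r))_{h∈J} ∈ (F^r)^{k−1} is a bijection. (This holds because the (k−1)×(k−1) matrix with entries α_h^κ, h ∈ J, 1 ≤ κ ≤ k−1, is invertible, the α_h being distinct and nonzero.) -/
/-- Shamir share of a secret vector `x ∈ F^r` with randomness vectors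
`rand (1),…,rand (k-1) ∈ F^r` at evaluation point `α h`. -/
def shamirShare {F : Type*} [Field F] {r n k : ℕ} (α : Fin n → F)
    (x : Fin r → F) (rand : Fin (k - 1) → Fin r → F) (h : Fin n) : Fin r → F :=
  x + ∑ κ : Fin (k - 1), (α h ^ (κ.1 + 1)) • rand κ

/-- For every fixed secret `x` and every set `J` of exactly `k-1` share indices, the map
sending the randomness tuple `(r^{(1)},…,r^{(k-1)})` to the tuple of shares
`(s^{(h)}(x, r))_{h∈J}` is a bijection. -/
theorem stmt3 {F : Type*} [Field F] {r n k : ℕ} (hk1 : 1 ≤ k) (hkn : k ≤ n)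
    (α : Fin n → F) (hα : Function.Injective α) (hα0 : ∀ h : Fin n, α h ≠ 0)
    (x : Fin r → F) (J : Finset (Fin n)) (hJ : J.card = k - 1) :
    Function.Bijective (fun (rand : Fin (k - 1) → Fin r → F) (h : J) =>
      shamirShare α x rand h.1) := by
  let e : Fin (k - 1) ≃ J := (J.equivFinOfCardEq hJ).symm
  let v : Fin (k - 1) → F := fun i => α (e i).1
  let M : Matrix (Fin (k - 1)) (Fin (k - 1)) F := Matrix.of fun i κ => v i ^ (κ.1 + 1)
  have hM : M = Matrix.diagonal v * Matrix.vandermonde v := by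
    ext i κ
    simp [M, Matrix.diagonal_mul, Matrix.vandermonde_apply, pow_succ']
  have hv : Function.Injective v := fun i j hij =>
    e.injective (Subtype.ext (hα hij))
  have hdet : IsUnit M.det := by
    rw [hM, Matrix.det_mul, Matrix.det_diagonal, isUnit_iff_ne_zero]
    exact mul_ne_zero (Finset.prod_ne_zero_iff.mpr fun i _ => hα0 _)
      (Matrix.det_vandermonde_ne_zero_iff.mpr hv)
  have key : ∀ (rand : Fin (k - 1) → Fin r → F) (i : Fin (k - 1)) (c : Fin r),
      shamirShare α x rand (e i).1 c = x c + (M * (Matrix.of rand)) i c := by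
    intro rand i c
    simp [shamirShare, Matrix.mul_apply, M, v, Finset.sum_apply]
  constructor
  · intro a b hab
    have h : M * Matrix.of a = M * Matrix.of b := by
      ext i c
      have h1 := congrFun (congrFun hab (e i)) c
      simp only [key] at h1
      exact add_left_cancel h1
    have h2 := congrArg (fun N => M⁻¹ * N) h
    simp only [Matrix.nonsing_inv_mul_cancel_left M _ hdet] at h2
    exact Matrix.of.injective h2
  · intro s
    refine ⟨Matrix.of.symm (M⁻¹ * Matrix.of fun i c => s (e i) c - x c), ?_⟩
    funext h c
    obtain ⟨i, rfl⟩ := e.surjective h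
    simp only [key]
    rw [Equiv.apply_symm_apply, Matrix.mul_nonsing_inv_cancel_left M _ hdet]
    simp
end

section
/- (Privacy part of Theorem 1, uniformity form.) Let F be a finite field. For every secret x ∈ F^r and every subset J ⊆ {0,…,n−1} with |J| ≤ k−1, if the randomness vectors r^{(1)},…,r^{(k−1)} are drawn independently and uniformly from F^r, then the tuple of shares (s^{(h)}(x, r))_{h∈J} is uniformly distributed on (F^r)^{|J|}. In particular, this distribution is the same for every secret x, so the shares indexed by any k−1 or fewer indices reveal no information about x. -/
theorem map_uniform_aux {A B : Type*} [Fintype A] [Nonempty A] [Fintype B] [Nonempty B]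
    (f : A → B) (h : ∀ b c : B, ∃ e : A ≃ A, ∀ a, b = f (e a) ↔ c = f a) :
    (PMF.uniformOfFintype A).map f = PMF.uniformOfFintype B := by
  classical
  set p := (PMF.uniformOfFintype A).map f with hp
  have hc : ∀ b c, p b = p c := by
    intro b c
    obtain ⟨e, he⟩ := h b c
    rw [hp, PMF.map_apply, PMF.map_apply, ← e.tsum_eq]
    refine tsum_congr fun a => ?_
    simp only [he, PMF.uniformOfFintype_apply]
  ext b
  have h1 := p.tsum_coe
  rw [tsum_fintype, Finset.sum_congr rfl (fun c _ => hc c b), Finset.sum_const,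
    Finset.card_univ, nsmul_eq_mul] at h1
  rw [PMF.uniformOfFintype_apply]
  exact ENNReal.eq_inv_of_mul_eq_one_left (by rw [mul_comm]; exact h1)

theorem shamir_interp {F : Type*} [Field F] {n m : ℕ}
    (α : Fin n → F) (hα : Function.Injective α) (hα0 : ∀ h : Fin n, α h ≠ 0)
    (J : Finset (Fin n)) (hJ : J.card ≤ m) (y : J → F) :
    ∃ c : Fin m → F, ∀ h : J, ∑ κ : Fin m, α h.1 ^ (κ.1 + 1) * c κ = y h := by
  classical
  have hinj : Set.InjOn (fun h : J => α h.1) (Finset.univ : Finset J) :=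
    fun a _ b _ hab => Subtype.ext (hα hab)
  set p := Lagrange.interpolate (Finset.univ : Finset J) (fun h : J => α h.1)
    (fun h => y h / α h.1) with hp
  have hdeg : p.degree < (m : WithBot ℕ) := by
    refine (Lagrange.degree_interpolate_lt _ hinj).trans_le ?_
    simpa using hJ
  refine ⟨fun κ => p.coeff κ.1, fun h => ?_⟩
  have hm : 0 < m := (Finset.card_pos.mpr ⟨h.1, h.2⟩).trans_le hJ
  have hnd : p.natDegree < m := by
    by_cases h0 : p = 0
    · simpa [h0] using hm
    · exact (Polynomial.natDegree_lt_iff_degree_lt h0).2 hdeg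
  have he : p.eval (α h.1) = y h / α h.1 :=
    Lagrange.eval_interpolate_at_node (r := fun h : J => y h / α h.1) hinj (Finset.mem_univ h)
  rw [Polynomial.eval_eq_sum_range' hnd, ← Fin.sum_univ_eq_sum_range
    (fun i => p.coeff i * α h.1 ^ i)] at he
  rw [eq_div_iff (hα0 _), Finset.sum_mul] at he
  rw [← he]
  exact Finset.sum_congr rfl fun κ _ => by ring

/-- Privacy part of Theorem 1 (uniformity form): over a finite field, for every secret
`x` and every set `J` of at most `k-1` share indices, if the randomness vectors are
drawn independently and uniformly, then the tuple of shares `(s^{(h)}(x, r))_{h∈J}` is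
uniformly distributed on `(F^r)^{|J|}`; in particular it is the same for every `x`. -/
theorem stmt4 {F : Type*} [Field F] [Fintype F] {r n k : ℕ} (hk1 : 1 ≤ k) (hkn : k ≤ n)
    (α : Fin n → F) (hα : Function.Injective α) (hα0 : ∀ h : Fin n, α h ≠ 0)
    (x : Fin r → F) (J : Finset (Fin n)) (hJ : J.card ≤ k - 1) :
    (PMF.uniformOfFintype (Fin (k - 1) → Fin r → F)).map
        (fun rand (h : J) => shamirShare α x rand h.1) =
      PMF.uniformOfFintype (J → Fin r → F) := by
  apply map_uniform_aux
  intro b c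
  choose t ht using fun i : Fin r =>
    shamir_interp α hα hα0 J hJ (fun h => b h i - c h i)
  refine ⟨Equiv.addRight (fun κ i => t i κ), fun a => ?_⟩
  have key : (fun h : J => shamirShare α x (a + fun κ i => t i κ) h.1)
      = (fun h : J => shamirShare α x a h.1) + (b - c) := by
    funext h i
    have := ht i h
    simp only [shamirShare, Pi.add_apply, Pi.sub_apply, Finset.sum_apply, Pi.smul_apply,
      smul_eq_mul, mul_add, Finset.sum_add_distrib, this, add_assoc]
  rw [Equiv.coe_addRight, key]
  constructor
  · intro h
    have := congrArg (fun z => z - (b - c)) h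
    simpa using this
  · intro h
    rw [← h]
    simp
end

section
/- (Combinatorial core of Theorem 2: complete coverage of intermediate results.) Let π be a permutation of {0,…,e−1} whose cyclic group has order e and acts transitively on {0,…,e−1}, let 1 ≤ p ≤ e, let n ≤ e, and set β = ⌈e/p⌉ − 1. For j ∈ {0,…,e−1} define I_j^w = {π^s(j) : 0 ≤ s ≤ p−1} and I_j^s = {π^{t(e−p)}(j) : 0 ≤ t ≤ β} \ {n, n+1, …, e−1}. Then for every share index h ∈ {0,…,n−1} and every submatrix index l ∈ {0,…,e−1}, there exists an edge node j ∈ {0,…,e−1} such that h ∈ I_j^s and l ∈ I_j^w; i.e., every product W_l S^{(h)} with h < n is computed by some edge node. -/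
/-- Combinatorial core of Theorem 2 (complete coverage of intermediate results): with
`π` an `e`-cycle, `1 ≤ p ≤ e`, `n ≤ e`, `I_j^w = {π^s(j) : 0 ≤ s ≤ p−1}` and
`I_j^s = {π^{t(e−p)}(j) : 0 ≤ t ≤ ⌈e/p⌉−1} \ {n,…,e−1}`, every pair of a share index
`h < n` and a submatrix index `l` is covered by some edge node `j` with `h ∈ I_j^s`
and `l ∈ I_j^w`; i.e., every product `W_l S^{(h)}` is computed by some edge node.
Here `⌈e/p⌉ = (e + p - 1) / p`. -/
theorem stmt10 {e : ℕ} (π : Equiv.Perm (Fin e)) (hord : orderOf π = e)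
    (htrans : ∀ a b : Fin e, ∃ m : ℕ, (π ^ m) a = b)
    (p n : ℕ) (hp1 : 1 ≤ p) (hpe : p ≤ e) (hne : n ≤ e) :
    ∀ h l : Fin e, h.1 < n →
      ∃ j : Fin e,
        (∃ t < (e + p - 1) / p, (π ^ (t * (e - p))) j = h) ∧
        (∃ s < p, (π ^ s) j = l) := by
  intro h l _
  obtain ⟨m, hm⟩ := htrans h l
  have he : 0 < e := by omega
  have hpe1 : π ^ e = 1 := by
    have := pow_orderOf_eq_one π
    rwa [hord] at this
  have hm2 : (π ^ (m % e)) h = l := by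
    rw [← hm, ← pow_mod_orderOf π m, hord]
  have hlt : m % e < e := Nat.mod_lt _ he
  generalize m % e = k at hm2 hlt
  refine ⟨(π ^ (k / p * p)) h, ⟨k / p, ?_, ?_⟩, k % p, Nat.mod_lt _ hp1, ?_⟩
  · have h1 : k / p ≤ (e - 1) / p := Nat.div_le_div_right (by omega)
    have h2 : (e + p - 1) / p = (e - 1) / p + 1 := by
      rw [← Nat.add_div_right _ hp1]
      congr 1
      omega
    omega
  · rw [← Equiv.Perm.mul_apply, ← pow_add, ← Nat.mul_add, Nat.sub_add_cancel hpe,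
      Nat.mul_comm, pow_mul, hpe1, one_pow, Equiv.Perm.one_apply]
  · rw [← Equiv.Perm.mul_apply, ← pow_add, Nat.mul_comm, Nat.mod_add_div, hm2]
end

section
/- (Theorem 2.) Consider u users with private data x_0,…,x_{u−1} ∈ F^r over a finite field F, shared via Shamir's (n,k) scheme with n ≤ e distinct nonzero evaluation points, giving matrices of shares S^{(0)},…,S^{(n−1)} ∈ F^{r×u}. Let W ∈ F^{m×r} be partitioned into e row-blocks W_0,…,W_{e−1} (assume e divides m), let π be a permutation of {0,…,e−1} generating a transitive cyclic group of order e, let 1 ≤ p ≤ e, and for j ∈ {0,…,e−1} let edge node j store {W_l : l ∈ I_j^w} with I_j^w = {π^s(j) : 0 ≤ s ≤ p−1}, receive {S^{(h)} : h ∈ I_j^s} with I_j^s = {π^{t(e−p)}(j) : 0 ≤ t ≤ ⌈e/p⌉−1} \ {n,…,e−1}, and return the computations {W_l S^{(h)} : l ∈ I_j^w, h ∈ I_j^s}. Then the union over all j of these returned computations determines the desired computations W x_0,…,W x_{u−1} of all users. -/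
/-- The matrix of shares `S^{(h)} ∈ F^{r×u}` whose `i`-th column is the share
`s^{(h)}(x_i, r_i)` of user `i`. -/
def sharesMatrix {F : Type*} [Field F] {r u n k : ℕ} (α : Fin n → F)
    (x : Fin u → Fin r → F) (rand : Fin u → Fin (k - 1) → Fin r → F)
    (h : Fin n) : Matrix (Fin r) (Fin u) F :=
  Matrix.of fun ρ i => shamirShare α (x i) (rand i) h ρ

/-- The `l`-th row-block `W_l ∈ F^{(m/e)×r}` of `W ∈ F^{m×r}` (with `m = e·c`). -/
def rowBlock {F : Type*} [Field F] {e c r : ℕ} (W : Matrix (Fin (e * c)) (Fin r) F)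
    (l : Fin e) : Matrix (Fin c) (Fin r) F :=
  Matrix.of fun t j => W ⟨l.1 * c + t.1, by
    calc l.1 * c + t.1 < l.1 * c + c := Nat.add_lt_add_left t.2 _
      _ = (l.1 + 1) * c := by ring
      _ ≤ e * c := Nat.mul_le_mul_right c l.2⟩ j

open Polynomial in
theorem shamir_aux {F : Type*} [Field F] {n k : ℕ} (hk1 : 1 ≤ k) (hkn : k ≤ n)
    (α : Fin n → F) (hα : Function.Injective α) (y : F) (z : Fin (k - 1) → F)
    (h0 : ∀ h, y + ∑ κ : Fin (k - 1), α h ^ (κ.1 + 1) * z κ = 0) : y = 0 := by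
  set P : F[X] := C y + ∑ κ : Fin (k - 1), C (z κ) * X ^ (κ.1 + 1) with hP
  have hdeg : P.natDegree ≤ k - 1 := by
    refine natDegree_add_le_of_degree_le (by simp) ?_
    refine natDegree_sum_le_of_forall_le _ _ fun κ _ => ?_
    exact (natDegree_C_mul_X_pow_le _ _).trans (by have := κ.2; omega)
  have hz : P = 0 := by
    refine eq_zero_of_natDegree_lt_card_of_eval_eq_zero P hα (fun h => ?_) ?_
    · refine Eq.trans ?_ (h0 h)
      rw [hP, eval_add, eval_C, eval_finsetSum]
      congr 1
      refine Finset.sum_congr rfl fun κ _ => ?_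
      rw [eval_mul, eval_C, eval_pow, eval_X, mul_comm]
    · rw [Fintype.card_fin]; omega
  have := congrArg (eval 0) hz
  simpa [hP, eval_finsetSum] using this

theorem cover_aux {e p : ℕ} (he : 0 < e) (hp1 : 1 ≤ p) (hpe : p ≤ e)
    (π : Equiv.Perm (Fin e)) (hord : orderOf π = e)
    (htrans : ∀ a b : Fin e, ∃ t : ℕ, (π ^ t) a = b) (l h : Fin e) :
    ∃ j, (∃ s < p, (π ^ s) j = l) ∧ (∃ t < (e + p - 1) / p, (π ^ (t * (e - p))) j = h) := by
  obtain ⟨d', hd'⟩ := htrans h l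
  obtain ⟨d, hde, hd⟩ : ∃ d < e, (π ^ d) h = l := by
    refine ⟨d' % e, Nat.mod_lt _ he, ?_⟩
    have := pow_mod_orderOf π d'
    rw [hord] at this
    rw [this, hd']
  refine ⟨(π ^ (d / p * p)) h, ⟨d % p, Nat.mod_lt _ hp1, ?_⟩, ⟨d / p, ?_, ?_⟩⟩
  · rw [← Equiv.Perm.mul_apply, ← pow_add, Nat.mod_add_div', hd]
  · rw [Nat.lt_iff_add_one_le, Nat.le_div_iff_mul_le hp1, add_mul, one_mul]
    have := Nat.div_mul_le_self d p
    omega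
  · rw [← Equiv.Perm.mul_apply, ← pow_add, ← mul_add, Nat.sub_add_cancel hpe, mul_comm, pow_mul]
    have : π ^ e = 1 := by
      have := pow_orderOf_eq_one π
      rwa [hord] at this
    simp [this]

theorem row_aux {F : Type*} [Field F] {r u n k : ℕ} (α : Fin n → F)
    (x : Fin u → Fin r → F) (rand : Fin u → Fin (k - 1) → Fin r → F) (h : Fin n)
    (w : Fin r → F) (i : Fin u) :
    ∑ ρ, w ρ * sharesMatrix α x rand h ρ i =
      w ⬝ᵥ x i + ∑ κ : Fin (k - 1), α h ^ (κ.1 + 1) * (w ⬝ᵥ rand i κ) := by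
  have : ∑ ρ, w ρ * sharesMatrix α x rand h ρ i
      = w ⬝ᵥ (x i + ∑ κ : Fin (k - 1), (α h ^ (κ.1 + 1)) • rand i κ) := rfl
  rw [this, dotProduct_add, dotProduct_sum]
  simp [dotProduct_smul]

/-- Theorem 2: edge node `j` stores `{W_l : l ∈ I_j^w}`, receives `{S^{(h)} : h ∈ I_j^s}`
and returns `{W_l S^{(h)} : l ∈ I_j^w, h ∈ I_j^s}`, where
`I_j^w = {π^s(j) : 0 ≤ s ≤ p−1}` and
`I_j^s = {π^{t(e−p)}(j) : 0 ≤ t ≤ ⌈e/p⌉−1} \ {n,…,e−1}` (with `⌈e/p⌉ = (e+p-1)/p`).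
The union over all `j` of these returned computations determines the desired
computations `W x_0,…,W x_{u−1}` of all users: any two choices of user data and
randomness producing the same returned computations yield the same results `W x_i`. -/
theorem stmt11 {F : Type*} [Field F] [Fintype F] {u r n k e c p : ℕ}
    (hk1 : 1 ≤ k) (hkn : k ≤ n) (hne : n ≤ e) (hp1 : 1 ≤ p) (hpe : p ≤ e)
    (α : Fin n → F) (hα : Function.Injective α) (hα0 : ∀ h : Fin n, α h ≠ 0)
    (π : Equiv.Perm (Fin e)) (hord : orderOf π = e)
    (htrans : ∀ a b : Fin e, ∃ t : ℕ, (π ^ t) a = b)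
    (W : Matrix (Fin (e * c)) (Fin r) F)
    (x x' : Fin u → Fin r → F)
    (rand rand' : Fin u → Fin (k - 1) → Fin r → F)
    (hsame : ∀ (j l : Fin e) (h : Fin n),
      (∃ s < p, (π ^ s) j = l) →
      (∃ t < (e + p - 1) / p, (π ^ (t * (e - p))) j = Fin.castLE hne h) →
      rowBlock W l * sharesMatrix α x rand h = rowBlock W l * sharesMatrix α x' rand' h) :
    ∀ i : Fin u, W.mulVec (x i) = W.mulVec (x' i) := by
  intro i
  have he : 0 < e := by omega
  funext a
  have hc : 0 < c := Nat.pos_of_ne_zero (by rintro rfl; exact absurd a.2 (by simp))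
  have hl : a.1 / c < e := Nat.div_lt_of_lt_mul (a.2.trans_eq (mul_comm e c))
  have key : ∀ h : Fin n, ∑ ρ, W a ρ * sharesMatrix α x rand h ρ i
      = ∑ ρ, W a ρ * sharesMatrix α x' rand' h ρ i := by
    intro h
    obtain ⟨j, h1, h2⟩ := cover_aux he hp1 hpe π hord htrans ⟨a.1 / c, hl⟩ (Fin.castLE hne h)
    have := congrFun (congrFun (hsame j _ h h1 h2) ⟨a.1 % c, Nat.mod_lt _ hc⟩) i
    simpa only [Matrix.mul_apply, rowBlock, Matrix.of_apply, Nat.div_add_mod'] using this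
  have := shamir_aux hk1 hkn α hα (W a ⬝ᵥ x i - W a ⬝ᵥ x' i)
    (fun κ => W a ⬝ᵥ rand i κ - W a ⬝ᵥ rand' i κ) (fun h => by
      have := key h
      rw [row_aux, row_aux] at this
      simp only [mul_sub, Finset.sum_sub_distrib]
      linear_combination this)
  exact sub_eq_zero.mp this
end

section
/- (Privacy level of the combined scheme.) Let F be a finite field, let the u users share their data x_0,…,x_{u−1} ∈ F^r via Shamir's (n,k) scheme with independent uniform randomness, and suppose each edge node j ∈ {0,…,e−1} is assigned a set I_j^s ⊆ {0,…,n−1} of share indices with |I_j^s| ≤ a. If k ≥ a·z + 1, then for every set Z ⊆ {0,…,e−1} of z edge nodes, the joint distribution of all shares observed by those nodes, namely the tuple (s^{(h)}(x_i, r_i))_{h ∈ ⋃_{j∈Z} I_j^s, 0 ≤ i ≤ u−1}, is the same for every choice of the users' secrets x_0,…,x_{u−1}; i.e., any z colluding edge nodes gain no information about the users' data. -/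
open Polynomial in
theorem exists_mask {F : Type*} [Field F] {n m : ℕ} (α : Fin n → F)
    (hα0 : ∀ h : Fin n, α h ≠ 0) (S : Finset (Fin n)) (hS : S.card ≤ m) :
    ∃ c : Fin m → F, ∀ h ∈ S, ∑ κ : Fin m, α h ^ (κ.1 + 1) * c κ = 1 := by
  set q : F[X] := ∏ h ∈ S, (1 - C ((α h)⁻¹) * X) with hq
  have h0 : q.coeff 0 = 1 := by
    rw [coeff_zero_eq_eval_zero, hq, eval_prod]
    simp
  have hdeg : q.natDegree < m + 1 := by
    have h1 : q.natDegree ≤ ∑ h ∈ S, (1 - C ((α h)⁻¹) * X : F[X]).natDegree :=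
      natDegree_prod_le _ _
    have h2 : ∑ h ∈ S, (1 - C ((α h)⁻¹) * X : F[X]).natDegree ≤ ∑ h ∈ S, 1 := by
      apply Finset.sum_le_sum
      intro h _
      compute_degree
    simp at h2
    omega
  refine ⟨fun κ => - q.coeff (κ.1 + 1), fun h hh => ?_⟩
  have he : q.eval (α h) = 0 := by
    rw [hq, eval_prod]
    apply Finset.prod_eq_zero hh
    simp [hα0 h]
  rw [eval_eq_sum_range' hdeg, Finset.sum_range_succ', h0] at he
  rw [Fin.sum_univ_eq_sum_range (fun κ => α h ^ (κ + 1) * - q.coeff (κ + 1)) m]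
  have : ∑ κ ∈ Finset.range m, α h ^ (κ + 1) * - q.coeff (κ + 1)
      = - ∑ κ ∈ Finset.range m, q.coeff (κ + 1) * α h ^ (κ + 1) := by
    rw [← Finset.sum_neg_distrib]
    exact Finset.sum_congr rfl fun _ _ => by ring
  rw [this]
  linear_combination -he

theorem uniform_map_equiv {A : Type*} [Fintype A] [Nonempty A] (g : A ≃ A) :
    (PMF.uniformOfFintype A).map g = PMF.uniformOfFintype A := by
  classical
  ext b
  rw [PMF.map_apply, tsum_eq_single (g.symm b)]
  · simp
  · intro b' hb'
    rw [if_neg]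
    rintro rfl
    simp at hb'

/-- Privacy level of the combined scheme: if each edge node `j` is assigned a set
`I_j^s ⊆ {0,…,n−1}` of at most `a` share indices and `k ≥ a·z + 1`, then for every set
`Z` of `z` edge nodes, the joint distribution (under per-user independent uniform
randomness) of all shares observed by those nodes,
`(s^{(h)}(x_i, r_i))_{h ∈ ⋃_{j∈Z} I_j^s, i}`, is the same for every choice of the
users' secrets: any `z` colluding edge nodes gain no information about the data. -/
theorem stmt12 {F : Type*} [Field F] [Fintype F] {r u n k e a z : ℕ}
    (hk1 : 1 ≤ k) (hkn : k ≤ n)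
    (α : Fin n → F) (hα : Function.Injective α) (hα0 : ∀ h : Fin n, α h ≠ 0)
    (Isets : Fin e → Finset (Fin n)) (hIa : ∀ j : Fin e, (Isets j).card ≤ a)
    (hkz : a * z + 1 ≤ k)
    (Z : Finset (Fin e)) (hZ : Z.card = z)
    (x x' : Fin u → Fin r → F) :
    (PMF.uniformOfFintype (Fin u → Fin (k - 1) → Fin r → F)).map
        (fun rand (hi : {h : Fin n // h ∈ Z.biUnion Isets} × Fin u) =>
          shamirShare α (x hi.2) (rand hi.2) hi.1.1) =
      (PMF.uniformOfFintype (Fin u → Fin (k - 1) → Fin r → F)).map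
        (fun rand (hi : {h : Fin n // h ∈ Z.biUnion Isets} × Fin u) =>
          shamirShare α (x' hi.2) (rand hi.2) hi.1.1) := by
  have hS : (Z.biUnion Isets).card ≤ k - 1 := by
    have h1 : (Z.biUnion Isets).card ≤ Z.card * a :=
      Finset.card_biUnion_le_card_mul _ _ _ fun j _ => hIa j
    rw [hZ, mul_comm] at h1
    omega
  obtain ⟨c, hc⟩ := exists_mask α hα0 _ hS
  let d : Fin u → Fin (k - 1) → Fin r → F := fun i κ => c κ • (x i - x' i)
  conv_rhs => rw [← uniform_map_equiv (Equiv.addRight d), PMF.map_comp]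
  congr 1
  funext rand hi
  obtain ⟨⟨h, hh⟩, i⟩ := hi
  have hd : ∑ κ : Fin (k - 1), (α h ^ (κ.1 + 1)) • d i κ = x i - x' i := by
    simp only [d, smul_smul]
    rw [← Finset.sum_smul, hc h hh, one_smul]
  simp only [shamirShare, Function.comp, Equiv.coe_addRight, Pi.add_apply, smul_add,
    Finset.sum_add_distrib]
  rw [hd]
  abel
end
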